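/- arXiv:2207.03291 — 5 statements merged into one kernel-verified Lean document; each statement's English description precedes it below -/
import Mathlib

section
/- Suppose the scalar L̄ satisfies L̄ > υ*, where υ* is the optimal value of the two-stage robust problem. Then for any scenario set S ⊆ Ξ, the optimal value of the master problem with right-hand side L̄ equals L̄, i.e., inf { c·x + δ : x ∈ X, δ ∈ ℝ, δ ≥ Q(x,ξ) for all ξ ∈ S, c·x + δ ≥ L̄ } = L̄. (Proposition: optimal value of the inexact master problem when L̄ exceeds υ*.) -/
/-- Proposition: optimal value of the inexact master problem when `L̄` exceeds `υ*`.
`vstar` is the optimal value of the two-stage robust problem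
`inf_{x ∈ X} (c·x + sup_{ξ ∈ Ξ} Q(x,ξ))`, attained at `xstar ∈ X`.  If `L̄ > υ*`, then for
any scenario set `S ⊆ Ξ` the optimal value of the master problem with right-hand side `L̄`
equals `L̄`. -/
theorem inexact_master_value_eq_of_gt_vstar {n l : ℕ}
    (X : Set (Fin n → ℝ)) (Ξ : Set (Fin l → ℝ))
    (c : Fin n → ℝ) (Q : (Fin n → ℝ) → (Fin l → ℝ) → ℝ)
    (vstar : ℝ) (xstar : Fin n → ℝ) (hxstar : xstar ∈ X)
    (hne : (Q xstar '' Ξ).Nonempty) (hbdd : BddAbove (Q xstar '' Ξ))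
    (hattain : (∑ i, c i * xstar i) + sSup (Q xstar '' Ξ) = vstar)
    (hlow : ∀ x ∈ X, vstar ≤ (∑ i, c i * x i) + sSup (Q x '' Ξ))
    (S : Set (Fin l → ℝ)) (hS : S ⊆ Ξ) (Lbar : ℝ) (hLbar : Lbar > vstar) :
    sInf {v : ℝ | ∃ x ∈ X, ∃ δ : ℝ, (∀ ξ ∈ S, Q x ξ ≤ δ) ∧
      Lbar ≤ (∑ i, c i * x i) + δ ∧ v = (∑ i, c i * x i) + δ} = Lbar := by
  apply IsLeast.csInf_eq
  constructor
  · refine ⟨xstar, hxstar, Lbar - ∑ i, c i * xstar i, ?_, by linarith, by ring⟩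
    intro ξ hξ
    have h := le_csSup hbdd (Set.mem_image_of_mem (Q xstar) (hS hξ))
    linarith
  · rintro v ⟨x, _, δ, _, h, rfl⟩
    exact h
end

section
/- Let L̄, L ∈ ℝ satisfy L > L̄, and suppose L is a valid lower bound on the master problem with right-hand side L̄, i.e., L ≤ c·x + δ for every (x,δ) with x ∈ X, δ ∈ ℝ, δ ≥ Q(x,ξ) for all ξ ∈ S, and c·x + δ ≥ L̄. Then L is a valid lower bound on the optimal value of the two-stage robust problem: L ≤ υ*. (Proposition 1: validity of the lower bound L^ℓ recorded by the i-C&CG method.) -/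
/-- Proposition 1: validity of the lower bound `L^ℓ` recorded by the i-C&CG method.
If `L > L̄` and `L` is a valid lower bound on the master problem with right-hand side `L̄`,
then `L` is a valid lower bound on the optimal value `υ*` of the two-stage robust problem. -/
theorem lower_bound_valid_for_two_stage_robust {n l : ℕ}
    (X : Set (Fin n → ℝ)) (Ξ : Set (Fin l → ℝ))
    (c : Fin n → ℝ) (Q : (Fin n → ℝ) → (Fin l → ℝ) → ℝ)
    (vstar : ℝ) (xstar : Fin n → ℝ) (hxstar : xstar ∈ X)
    (hne : (Q xstar '' Ξ).Nonempty) (hbdd : BddAbove (Q xstar '' Ξ))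
    (hattain : (∑ i, c i * xstar i) + sSup (Q xstar '' Ξ) = vstar)
    (hlow : ∀ x ∈ X, vstar ≤ (∑ i, c i * x i) + sSup (Q x '' Ξ))
    (S : Set (Fin l → ℝ)) (hS : S ⊆ Ξ) (Lbar L : ℝ) (hLLbar : L > Lbar)
    (hvalid : ∀ x ∈ X, ∀ δ : ℝ, (∀ ξ ∈ S, Q x ξ ≤ δ) →
      Lbar ≤ (∑ i, c i * x i) + δ → L ≤ (∑ i, c i * x i) + δ) :
    L ≤ vstar := by
  have hQ : ∀ ξ ∈ S, Q xstar ξ ≤ sSup (Q xstar '' Ξ) := fun ξ hξ =>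
    le_csSup hbdd ⟨ξ, hS hξ, rfl⟩
  by_contra hlt
  rw [not_le] at hlt
  have h := hvalid xstar hxstar
    (max (sSup (Q xstar '' Ξ)) (Lbar - ∑ i, c i * xstar i))
    (fun ξ hξ => (hQ ξ hξ).trans (le_max_left _ _))
    (by linarith [le_max_right (sSup (Q xstar '' Ξ)) (Lbar - ∑ i, c i * xstar i)])
  rcases max_choice (sSup (Q xstar '' Ξ)) (Lbar - ∑ i, c i * xstar i) with h' | h' <;>
    rw [h'] at h <;> linarith
end

section
/- Let ε_MP ∈ (0,1) and ε̃ ∈ (0,1), and let U, L, Ū ∈ ℝ satisfy U > 0, Ū > 0, L ≤ Ū, the inexact master optimality gap condition U − L ≤ ε_MP · U, and the inexact relative gap condition Ū − U < ε̃ · Ū. Then the actual relative gap satisfies (Ū − L)/Ū < (1 − ε̃)⁻¹ (1 − ε_MP)⁻¹ − 1. (Proposition 2, case j = ℓ: bound on the actual relative gap when the exploitation step is reached at the iteration that produced the valid lower bound.) -/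
/-- Proposition 2, case `j = ℓ`: bound on the actual relative gap when the exploitation step
is reached at the iteration that produced the valid lower bound. -/
theorem actual_gap_bound_base_case (εMP εtilde U L Ubar : ℝ)
    (hMP1 : 0 < εMP) (hMP2 : εMP < 1) (ht1 : 0 < εtilde) (ht2 : εtilde < 1)
    (hU : 0 < U) (hUbar : 0 < Ubar) (hLUbar : L ≤ Ubar)
    (hgap : U - L ≤ εMP * U) (hin : Ubar - U < εtilde * Ubar) :
    (Ubar - L) / Ubar < (1 - εtilde)⁻¹ * (1 - εMP)⁻¹ - 1 := by
  have ha : 0 < 1 - εMP := by linarith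
  have hb : 0 < 1 - εtilde := by linarith
  have hp : 0 < (1 - εtilde) * (1 - εMP) := mul_pos hb ha
  have h1 : (1 - εtilde) * Ubar < U := by linarith
  have h2 : (1 - εMP) * ((1 - εtilde) * Ubar) < (1 - εMP) * U :=
    mul_lt_mul_of_pos_left h1 ha
  have h3 : (Ubar - L) / Ubar < 1 - (1 - εtilde) * (1 - εMP) := by
    rw [div_lt_iff₀ hUbar]
    linarith
  rw [← mul_inv]
  generalize (1 - εtilde) * (1 - εMP) = p at hp h3
  have h4 : p * p⁻¹ = 1 := mul_inv_cancel₀ hp.ne'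
  have h5 : 0 < p⁻¹ := inv_pos.mpr hp
  nlinarith [sq_nonneg (p - 1), mul_nonneg h5.le (sq_nonneg (p - 1))]
end

section
/- Let n ∈ ℕ, ε̃ ∈ (0,1), and let ε_0, ε_1, …, ε_n ∈ (0,1), U_0, U_1, …, U_n ∈ ℝ all positive, and L, Ū ∈ ℝ with L > 0, Ū > 0 and L ≤ Ū. Assume U_0 − L ≤ ε_0 · U_0, that (1 − ε_{k+1}) · U_{k+1} ≤ U_k for each k ∈ {0, …, n−1}, and that Ū − U_n < ε̃ · Ū. Then the actual relative gap satisfies (Ū − L)/Ū < (1 − ε̃)⁻¹ · ∏_{k=0}^{n} (1 − ε_k)⁻¹ − 1. (Proposition 2: bound on the actual relative gap when the exploitation step is reached after n further inexact master solves.) -/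
/-- Proposition 2: bound on the actual relative gap when the exploitation step is reached
after `n` further inexact master solves. -/
theorem actual_gap_bound_general (n : ℕ) (εtilde : ℝ) (ht1 : 0 < εtilde) (ht2 : εtilde < 1)
    (ε U : ℕ → ℝ)
    (hε : ∀ k ≤ n, 0 < ε k ∧ ε k < 1)
    (hU : ∀ k ≤ n, 0 < U k)
    (L Ubar : ℝ) (hL : 0 < L) (hUbar : 0 < Ubar) (hLUbar : L ≤ Ubar)
    (h0 : U 0 - L ≤ ε 0 * U 0)
    (hrec : ∀ k < n, (1 - ε (k + 1)) * U (k + 1) ≤ U k)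
    (hin : Ubar - U n < εtilde * Ubar) :
    (Ubar - L) / Ubar <
      (1 - εtilde)⁻¹ * (∏ k ∈ Finset.range (n + 1), (1 - ε k)⁻¹) - 1 := by
  have hpos : ∀ m ≤ n, 0 < ∏ k ∈ Finset.range (m + 1), (1 - ε k) := by
    intro m hm
    apply Finset.prod_pos
    intro k hk
    have hk' := Finset.mem_range.mp hk
    linarith [(hε k (by omega)).2]
  have key : ∀ m ≤ n, (∏ k ∈ Finset.range (m + 1), (1 - ε k)) * U m ≤ L := by
    intro m
    induction m with
    | zero =>
      intro _
      simp only [zero_add, Finset.prod_range_one]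
      linarith
    | succ m ih =>
      intro hm
      rw [Finset.prod_range_succ, mul_assoc]
      exact (mul_le_mul_of_nonneg_left (hrec m (by omega)) (hpos m (by omega)).le).trans
        (ih (by omega))
  have hP := hpos n le_rfl
  have hK := key n le_rfl
  rw [Finset.prod_inv_distrib, ← mul_inv]
  set P := ∏ k ∈ Finset.range (n + 1), (1 - ε k)
  have hq : 0 < (1 - εtilde) * P := mul_pos (by linarith) hP
  have h1 : (1 - εtilde) * P * Ubar < L := by
    have h2 : P * ((1 - εtilde) * Ubar) < P * U n :=
      mul_lt_mul_of_pos_left (by linarith) hP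
    linarith
  have h3 : (Ubar - L) / Ubar < 1 - (1 - εtilde) * P := by
    rw [div_lt_iff₀ hUbar]
    linarith
  generalize (1 - εtilde) * P = q at *
  have h4 : 2 - q ≤ q⁻¹ := by
    rw [← one_div, le_div_iff₀ hq]
    nlinarith [sq_nonneg (q - 1)]
  linarith
end

section
/- Let I and R be finite index sets, y : I × R → ℝ, η, φ, μ, lo, hi : I → ℝ, and T ∈ ℝ, with lo_i ≤ μ_i ≤ hi_i and φ_i ≥ 0 for all i ∈ I, and Ξ = { d : I → ℝ : lo_i ≤ d_i ≤ hi_i for all i }. Set Δ̲_i = μ_i − lo_i and Δ̄_i = hi_i − μ_i. Then sup_{d∈Ξ} [ ∑_{r∈R} ( ∑_{i∈I} y_{ir} d_i − T )⁺ − ∑_{i∈I} ( d_i η_i + |d_i − μ_i| φ_i ) ] equals the maximum, over π : R → ℝ with 0 ≤ π_r ≤ 1, binary b¹, b² : I → {0,1} with b¹_i + b²_i ≤ 1 for all i, and ζ¹, ζ² : I × R → ℝ satisfying the McCormick constraints ζ¹_{ir} ≥ 0, ζ¹_{ir} ≥ π_r + b¹_i − 1, ζ¹_{ir} ≤ π_r,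 ζ¹_{ir} ≤ b¹_i and ζ²_{ir} ≥ 0, ζ²_{ir} ≥ π_r + b²_i − 1, ζ²_{ir} ≤ π_r, ζ²_{ir} ≤ b²_i, of the objective −T ∑_{r∈R} π_r + ∑_{i∈I} [ μ_i ( ∑_{r∈R} π_r y_{ir} − η_i ) − Δ̲_i ( ∑_{r∈R} ζ¹_{ir} y_{ir} − η_i b¹_i ) + Δ̄_i ( ∑_{r∈R} ζ²_{ir} y_{ir} − η_i b²_i ) − φ_i ( b¹_i Δ̲_i + b²_i Δ̄_i ) ]. (Proposition: exact mixed-integer linear programming reformulation of the i-C&CG subproblem for the distributionally robust operating room scheduling problem.) -/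
theorem aux_one (d μ lo hi φ a : ℝ) (hl : lo ≤ d) (hh : d ≤ hi) :
    ∃ b1 b2 : ℝ, ((b1 = 0 ∨ b1 = 1) ∧ (b2 = 0 ∨ b2 = 1) ∧ b1 + b2 ≤ 1) ∧
      d * a - |d - μ| * φ ≤ μ * a - (μ - lo) * (a * b1) + (hi - μ) * (a * b2)
        - φ * (b1 * (μ - lo) + b2 * (hi - μ)) := by
  rcases le_total d μ with h | h
  · rw [abs_of_nonpos (by linarith)]
    rcases le_total 0 (a + φ) with hs | hs
    · refine ⟨0, 0, by norm_num, ?_⟩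
      nlinarith [mul_nonneg hs (sub_nonneg.2 h)]
    · refine ⟨1, 0, by norm_num, ?_⟩
      nlinarith [mul_nonneg (neg_nonneg.2 hs) (sub_nonneg.2 hl)]
  · rw [abs_of_nonneg (by linarith)]
    rcases le_total 0 (a - φ) with hs | hs
    · refine ⟨0, 1, by norm_num, ?_⟩
      nlinarith [mul_nonneg hs (sub_nonneg.2 hh)]
    · refine ⟨0, 0, by norm_num, ?_⟩
      nlinarith [mul_nonneg (neg_nonneg.2 hs) (sub_nonneg.2 h)]

theorem aux_swap {I R : Type*} [Fintype I] [Fintype R]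
    (y : I → R → ℝ) (π : R → ℝ) (d : I → ℝ) (T : ℝ) (w : I → ℝ) :
    ∑ r, π r * (∑ i, y i r * d i - T) - ∑ i, w i =
      -T * ∑ r, π r + ∑ i, (d i * (∑ r, π r * y i r) - w i) := by
  simp only [mul_sub, Finset.sum_sub_distrib, Finset.mul_sum]
  rw [Finset.sum_comm]
  have e1 : ∑ i, ∑ r, π r * (y i r * d i) = ∑ i, ∑ r, d i * (π r * y i r) :=
    Finset.sum_congr rfl fun i _ => Finset.sum_congr rfl fun r _ => by ring
  have e2 : ∑ r, π r * T = - ∑ r, -T * π r := by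
    rw [← Finset.sum_neg_distrib]
    exact Finset.sum_congr rfl fun r _ => by ring
  rw [e1, e2]; ring

theorem aux_zeta (p b z : ℝ) (hb : b = 0 ∨ b = 1)
    (h : 0 ≤ z ∧ p + b - 1 ≤ z ∧ z ≤ p ∧ z ≤ b) : z = b * p := by
  obtain ⟨a1, a2, a3, a4⟩ := h
  rcases hb with rfl | rfl <;> linarith

theorem aux_mc (p b : ℝ) (hp : 0 ≤ p ∧ p ≤ 1) (hb : b = 0 ∨ b = 1) :
    0 ≤ b * p ∧ p + b - 1 ≤ b * p ∧ b * p ≤ p ∧ b * p ≤ b := by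
  obtain ⟨a1, a2⟩ := hp
  rcases hb with rfl | rfl <;> refine ⟨?_, ?_, ?_, ?_⟩ <;> linarith

/-- Proposition: exact mixed-integer linear programming reformulation of the i-C&CG
subproblem for the distributionally robust operating room scheduling problem. -/
theorem subproblem_milp_reformulation {I R : Type*} [Fintype I] [Fintype R]
    (y : I → R → ℝ) (η φ μ lo hi : I → ℝ) (T : ℝ)
    (h1 : ∀ i, lo i ≤ μ i) (h2 : ∀ i, μ i ≤ hi i) (hφ : ∀ i, 0 ≤ φ i) :
    ∃ m : ℝ,
      IsGreatest {v : ℝ | ∃ π : R → ℝ, ∃ b1 b2 : I → ℝ, ∃ ζ1 ζ2 : I → R → ℝ,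
        (∀ r, 0 ≤ π r ∧ π r ≤ 1) ∧
        (∀ i, (b1 i = 0 ∨ b1 i = 1) ∧ (b2 i = 0 ∨ b2 i = 1) ∧ b1 i + b2 i ≤ 1) ∧
        (∀ i r, 0 ≤ ζ1 i r ∧ π r + b1 i - 1 ≤ ζ1 i r ∧ ζ1 i r ≤ π r ∧ ζ1 i r ≤ b1 i) ∧
        (∀ i r, 0 ≤ ζ2 i r ∧ π r + b2 i - 1 ≤ ζ2 i r ∧ ζ2 i r ≤ π r ∧ ζ2 i r ≤ b2 i) ∧
        v = -T * ∑ r, π r + ∑ i, (μ i * (∑ r, π r * y i r - η i)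
          - (μ i - lo i) * (∑ r, ζ1 i r * y i r - η i * b1 i)
          + (hi i - μ i) * (∑ r, ζ2 i r * y i r - η i * b2 i)
          - φ i * (b1 i * (μ i - lo i) + b2 i * (hi i - μ i)))} m ∧
      sSup {v : ℝ | ∃ d : I → ℝ, (∀ i, lo i ≤ d i ∧ d i ≤ hi i) ∧
        v = ∑ r, max (∑ i, y i r * d i - T) 0 -
          ∑ i, (d i * η i + |d i - μ i| * φ i)} = m := by
  set F : (I → ℝ) → ℝ := fun d => ∑ r, max (∑ i, y i r * d i - T) 0 -
          ∑ i, (d i * η i + |d i - μ i| * φ i) with hF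
  have hcont : Continuous F := by rw [hF]; fun_prop
  obtain ⟨d0, hd0, hmax⟩ := (isCompact_Icc (a := lo) (b := hi)).exists_isMaxOn
    ⟨μ, h1, h2⟩ hcont.continuousOn
  have hmaxAll : ∀ d : I → ℝ, (∀ i, lo i ≤ d i ∧ d i ≤ hi i) → F d ≤ F d0 := fun d hd =>
    hmax (show d ∈ Set.Icc lo hi from ⟨fun i => (hd i).1, fun i => (hd i).2⟩)
  have hdZero : ∀ i, lo i ≤ d0 i ∧ d0 i ≤ hi i := fun i => ⟨hd0.1 i, hd0.2 i⟩
  refine ⟨F d0, ?_, ?_⟩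
  swap
  · refine IsGreatest.csSup_eq ⟨⟨d0, hdZero, rfl⟩, ?_⟩
    rintro v ⟨d, hd, rfl⟩
    exact hmaxAll d hd
  have hub : F d0 ∈ upperBounds {v : ℝ | ∃ π : R → ℝ, ∃ b1 b2 : I → ℝ, ∃ ζ1 ζ2 : I → R → ℝ,
        (∀ r, 0 ≤ π r ∧ π r ≤ 1) ∧
        (∀ i, (b1 i = 0 ∨ b1 i = 1) ∧ (b2 i = 0 ∨ b2 i = 1) ∧ b1 i + b2 i ≤ 1) ∧
        (∀ i r, 0 ≤ ζ1 i r ∧ π r + b1 i - 1 ≤ ζ1 i r ∧ ζ1 i r ≤ π r ∧ ζ1 i r ≤ b1 i) ∧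
        (∀ i r, 0 ≤ ζ2 i r ∧ π r + b2 i - 1 ≤ ζ2 i r ∧ ζ2 i r ≤ π r ∧ ζ2 i r ≤ b2 i) ∧
        v = -T * ∑ r, π r + ∑ i, (μ i * (∑ r, π r * y i r - η i)
          - (μ i - lo i) * (∑ r, ζ1 i r * y i r - η i * b1 i)
          + (hi i - μ i) * (∑ r, ζ2 i r * y i r - η i * b2 i)
          - φ i * (b1 i * (μ i - lo i) + b2 i * (hi i - μ i)))} := by
    rintro v ⟨π, b1, b2, ζ1, ζ2, hπ, hb, hz1, hz2, rfl⟩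
    set d : I → ℝ := fun i => μ i - b1 i * (μ i - lo i) + b2 i * (hi i - μ i) with hd
    have hdb : ∀ i, lo i ≤ d i ∧ d i ≤ hi i := by
      intro i
      obtain ⟨hb1, hb2, hb3⟩ := hb i
      have := h1 i
      have := h2 i
      simp only [hd]
      rcases hb1 with e1 | e1 <;> rcases hb2 with e2 | e2 <;> rw [e1, e2] at hb3 ⊢ <;>
        constructor <;> linarith
    refine le_trans ?_ (hmaxAll d hdb)
    have key : ∑ r, π r * (∑ i, y i r * d i - T) - ∑ i, (d i * η i + |d i - μ i| * φ i) ≤ F d := by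
      simp only [hF]
      gcongr with r
      obtain ⟨p0, p1⟩ := hπ r
      rcases le_total 0 (∑ i, y i r * d i - T) with h | h
      · rw [max_eq_left h]; nlinarith
      · rw [max_eq_right h]; nlinarith
    refine le_trans (le_of_eq ?_) key
    rw [aux_swap]
    congr 1
    refine Finset.sum_congr rfl fun i _ => ?_
    have e1 : ∑ r, ζ1 i r * y i r = b1 i * ∑ r, π r * y i r := by
      rw [Finset.mul_sum]
      exact Finset.sum_congr rfl fun r _ => by rw [aux_zeta _ _ _ (hb i).1 (hz1 i r)]; ring
    have e2 : ∑ r, ζ2 i r * y i r = b2 i * ∑ r, π r * y i r := by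
      rw [Finset.mul_sum]
      exact Finset.sum_congr rfl fun r _ => by rw [aux_zeta _ _ _ (hb i).2.1 (hz2 i r)]; ring
    have e3 : |d i - μ i| = b1 i * (μ i - lo i) + b2 i * (hi i - μ i) := by
      obtain ⟨hb1, hb2, hb3⟩ := hb i
      have := h1 i
      have := h2 i
      simp only [hd]
      rcases hb1 with e1 | e1 <;> rcases hb2 with e2 | e2 <;> rw [e1, e2] at hb3 ⊢
      · simp
      · rw [abs_of_nonneg] <;> linarith
      · rw [abs_of_nonpos] <;> linarith
      · linarith
    rw [e1, e2, e3]
    simp only [hd]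
    ring
  refine ⟨?_, hub⟩
  let π : R → ℝ := fun r => if 0 ≤ ∑ i, y i r * d0 i - T then 1 else 0
  have hπ : ∀ r, 0 ≤ π r ∧ π r ≤ 1 := by
    intro r
    simp only [π]
    split_ifs <;> norm_num
  choose b1 b2 hb hle using fun i => aux_one (d0 i) (μ i) (lo i) (hi i) (φ i)
    (∑ r, π r * y i r - η i) (hdZero i).1 (hdZero i).2
  have hmem := fun v hv => (⟨π, b1, b2, fun i r => b1 i * π r, fun i r => b2 i * π r, hπ, hb,
    fun i r => aux_mc _ _ (hπ r) (hb i).1, fun i r => aux_mc _ _ (hπ r) (hb i).2.1, hv⟩ :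
      v ∈ {v : ℝ | ∃ π : R → ℝ, ∃ b1 b2 : I → ℝ, ∃ ζ1 ζ2 : I → R → ℝ,
        (∀ r, 0 ≤ π r ∧ π r ≤ 1) ∧
        (∀ i, (b1 i = 0 ∨ b1 i = 1) ∧ (b2 i = 0 ∨ b2 i = 1) ∧ b1 i + b2 i ≤ 1) ∧
        (∀ i r, 0 ≤ ζ1 i r ∧ π r + b1 i - 1 ≤ ζ1 i r ∧ ζ1 i r ≤ π r ∧ ζ1 i r ≤ b1 i) ∧
        (∀ i r, 0 ≤ ζ2 i r ∧ π r + b2 i - 1 ≤ ζ2 i r ∧ ζ2 i r ≤ π r ∧ ζ2 i r ≤ b2 i) ∧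
        v = -T * ∑ r, π r + ∑ i, (μ i * (∑ r, π r * y i r - η i)
          - (μ i - lo i) * (∑ r, ζ1 i r * y i r - η i * b1 i)
          + (hi i - μ i) * (∑ r, ζ2 i r * y i r - η i * b2 i)
          - φ i * (b1 i * (μ i - lo i) + b2 i * (hi i - μ i)))})
  have hv := hmem _ rfl
  have hle2 := hub hv
  refine (le_antisymm hle2 ?_) ▸ hv
  have key : F d0 = ∑ r, π r * (∑ i, y i r * d0 i - T)
      - ∑ i, (d0 i * η i + |d0 i - μ i| * φ i) := by
    simp only [hF]
    congr 1
    refine Finset.sum_congr rfl fun r _ => ?_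
    simp only [π]
    split_ifs with h
    · rw [max_eq_left h, one_mul]
    · rw [max_eq_right (not_le.1 h).le, zero_mul]
  rw [key, aux_swap]
  refine add_le_add le_rfl (Finset.sum_le_sum fun i _ => ?_)
  have e (b : ℝ) : ∑ r, b * π r * y i r = b * ∑ r, π r * y i r := by
    rw [Finset.mul_sum]
    exact Finset.sum_congr rfl fun r _ => by ring
  rw [e, e]
  have := hle i
  linarith
end
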